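/- Let A₂₄, A₂₅, A₃₄, A₃₅, A₄₅ be real numbers, let G₁ be the antisymmetric 4 × 4 real matrix with rows: (0, −A₄₅², A₃₅A₄₅, −A₃₄A₄₅), (A₄₅², 0, −A₂₅A₄₅, A₂₄A₄₅), (−A₃₅A₄₅, A₂₅A₄₅, 0, A₂₅A₃₄ − A₂₄A₃₅), (A₃₄A₄₅, −A₂₄A₄₅, A₂₄A₃₅ − A₂₅A₃₄, 0), and let G be the 8 × 8 symmetric real matrix G = (1/2) · [[0, G₁], [G₁ᵀ, 0]] (block form). Set g = (1/4)·(A₄₅²·(A₂₄² + A₂₅² + A₃₄² + A₃₅² + A₄₅²) + (A₂₄A₃₅ − A₂₅A₃₄)²). Then the characteristic polynomial of G equals X⁴·(X² − g)²; equivalently, G has eigenvalues γ, −γ, 0 with respective multiplicities 2, 2, 4, where γ = √g. -/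

import Mathlib

open Polynomial in
/-- The characteristic polynomial of a block anti-diagonal matrix. -/
theorem Matrix.charpoly_fromBlocks_zero_diag {n R : Type*} [Fintype n] [DecidableEq n]
    [CommRing R] (B C : Matrix n n R) :
    (Matrix.fromBlocks 0 B C 0).charpoly =
      (Matrix.scalar n (X ^ 2 : R[X]) - B.map Polynomial.C * C.map Polynomial.C).det := by
  have hM : (Matrix.fromBlocks 0 B C 0).charmatrix =
      Matrix.fromBlocks (Matrix.scalar n (X : R[X])) (-B.map Polynomial.C)
        (-C.map Polynomial.C) (Matrix.scalar n (X : R[X])) := by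
    rw [Matrix.charmatrix_fromBlocks]
    simp [Matrix.charmatrix]
  have hmul : (Matrix.fromBlocks (Matrix.scalar n (X : R[X])) (-B.map Polynomial.C)
        (-C.map Polynomial.C) (Matrix.scalar n (X : R[X]))) *
      Matrix.fromBlocks (Matrix.scalar n (X : R[X])) 0 (C.map Polynomial.C) 1 =
      Matrix.fromBlocks (Matrix.scalar n (X ^ 2 : R[X]) - B.map Polynomial.C * C.map Polynomial.C)
        (-B.map Polynomial.C) 0 (Matrix.scalar n (X : R[X])) := by
    rw [Matrix.fromBlocks_multiply]
    have hcomm := (Matrix.scalar_commute (X : R[X]) (fun r => Commute.all _ r)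
      (C.map Polynomial.C)).eq
    congr 1
    · rw [pow_two, map_mul, neg_mul, sub_eq_add_neg]
    · simp
    · rw [hcomm, neg_mul, neg_add_cancel]
    · simp
  have hdet := congrArg Matrix.det hmul
  rw [Matrix.det_mul, Matrix.det_fromBlocks_zero₁₂, Matrix.det_fromBlocks_zero₂₁,
    Matrix.det_one, mul_one] at hdet
  have hreg : IsRightRegular (Matrix.scalar n (X : R[X])).det := by
    have : (Matrix.scalar n (X : R[X])).det = X ^ Fintype.card n := by
      simp [Matrix.scalar_apply, Matrix.det_diagonal]
    rw [this]
    exact ((monic_X_pow _).isRegular).right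
  rw [Matrix.charpoly, hM]
  exact hreg hdet

/-- For an antisymmetric `4 × 4` matrix `B`, the determinant of `y - B Bᵀ` in terms of the
sum of squares of the entries and the Pfaffian of `B`. -/
theorem Matrix.det_scalar_sub_antisymm_mul_transpose {R : Type*} [CommRing R]
    (y a b c d e f : R) (B : Matrix (Fin 4) (Fin 4) R)
    (hB : B = !![0, a, b, c; -a, 0, d, e; -b, -d, 0, f; -c, -e, -f, 0]) :
    (Matrix.scalar (Fin 4) y - B * B.transpose).det =
      (y ^ 2 - y * (a ^ 2 + b ^ 2 + c ^ 2 + d ^ 2 + e ^ 2 + f ^ 2) +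
        (a * f - b * e + c * d) ^ 2) ^ 2 := by
  have hmat : Matrix.scalar (Fin 4) y - B * B.transpose =
      !![y - (a ^ 2 + b ^ 2 + c ^ 2), -(b * d + c * e), a * d - c * f, a * e + b * f;
        -(b * d + c * e), y - (a ^ 2 + d ^ 2 + e ^ 2), -(a * b + e * f), d * f - a * c;
        a * d - c * f, -(a * b + e * f), y - (b ^ 2 + d ^ 2 + f ^ 2), -(b * c + d * e);
        a * e + b * f, d * f - a * c, -(b * c + d * e), y - (c ^ 2 + e ^ 2 + f ^ 2)] := by
    subst hB
    ext i j
    rw [Matrix.sub_apply, Matrix.mul_apply, Fin.sum_univ_four]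
    fin_cases i <;> fin_cases j <;> simp [Matrix.scalar_apply] <;> ring
  rw [hmat]
  simp [Matrix.det_succ_row_zero, Fin.sum_univ_succ, Fin.succAbove]
  ring


/-- The symmetric matrix `G = (1/2) · [[0, G₁], [G₁ᵀ, 0]]` of the degree-2 part of
`F₂₃` has characteristic polynomial `X⁴ · (X² − g)²`, i.e. eigenvalues
`√g, −√g, 0` with multiplicities `2, 2, 4`. -/
theorem charpoly_case2_matrix (A₂₄ A₂₅ A₃₄ A₃₅ A₄₅ : ℝ)
    (G₁ : Matrix (Fin 4) (Fin 4) ℝ)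
    (hG₁ : G₁ = !![0, -(A₄₅^2), A₃₅*A₄₅, -(A₃₄*A₄₅);
                   A₄₅^2, 0, -(A₂₅*A₄₅), A₂₄*A₄₅;
                   -(A₃₅*A₄₅), A₂₅*A₄₅, 0, A₂₅*A₃₄ - A₂₄*A₃₅;
                   A₃₄*A₄₅, -(A₂₄*A₄₅), A₂₄*A₃₅ - A₂₅*A₃₄, 0])
    (G : Matrix (Fin 4 ⊕ Fin 4) (Fin 4 ⊕ Fin 4) ℝ)
    (hG : G = (1/2 : ℝ) • Matrix.fromBlocks 0 G₁ (Matrix.transpose G₁) 0)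
    (g : ℝ)
    (hg : g = (1/4) * (A₄₅^2 * (A₂₄^2 + A₂₅^2 + A₃₄^2 + A₃₅^2 + A₄₅^2)
        + (A₂₄*A₃₅ - A₂₅*A₃₄)^2)) :
    G.charpoly = Polynomial.X ^ 4 * (Polynomial.X ^ 2 - Polynomial.C g) ^ 2 := by
  have hblock : G = Matrix.fromBlocks 0 ((1/2 : ℝ) • G₁) ((1/2 : ℝ) • G₁).transpose 0 := by
    rw [hG, Matrix.fromBlocks_smul, Matrix.transpose_smul, smul_zero]
  rw [hblock, Matrix.charpoly_fromBlocks_zero_diag, Matrix.transpose_map,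
    Matrix.det_scalar_sub_antisymm_mul_transpose (Polynomial.X ^ 2)
      (Polynomial.C (1/2 * -(A₄₅^2))) (Polynomial.C (1/2 * (A₃₅*A₄₅)))
      (Polynomial.C (1/2 * -(A₃₄*A₄₅))) (Polynomial.C (1/2 * -(A₂₅*A₄₅)))
      (Polynomial.C (1/2 * (A₂₄*A₄₅))) (Polynomial.C (1/2 * (A₂₅*A₃₄ - A₂₄*A₃₅)))]
  · simp only [← Polynomial.C_mul, ← Polynomial.C_add, ← Polynomial.C_sub, ← Polynomial.C_pow]
    have hsum : (1/2 * -(A₄₅^2))^2 + (1/2 * (A₃₅*A₄₅))^2 + (1/2 * -(A₃₄*A₄₅))^2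
        + (1/2 * -(A₂₅*A₄₅))^2 + (1/2 * (A₂₄*A₄₅))^2
        + (1/2 * (A₂₅*A₃₄ - A₂₄*A₃₅))^2 = g := by
      rw [hg]
      ring
    have hpf : 1/2 * -(A₄₅^2) * (1/2 * (A₂₅*A₃₄ - A₂₄*A₃₅))
        - 1/2 * (A₃₅*A₄₅) * (1/2 * (A₂₄*A₄₅))
        + 1/2 * -(A₃₄*A₄₅) * (1/2 * -(A₂₅*A₄₅)) = 0 := by
      ring
    rw [hsum, hpf, zero_pow two_ne_zero, Polynomial.C_0]
    ring
  · rw [hG₁]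
    ext1 i j
    fin_cases i <;> fin_cases j <;> simp <;> ring
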